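/- For a finite-dimensional vector superspace V with even dimension d₀ and odd dimension d₁, the dimension of the n-th symmetric superpower ⋁ⁿV equals Σ_{k=0}^{min(d₁,n)} C(d₁, k) · C(d₀ + (n-k) - 1, n-k). -/

import Mathlib

open scoped TensorProduct
open PiTensorProduct

namespace SuperPow

/-- parity of a basis index -/
def par {α β : Type} : α ⊕ β → ZMod 2 := Sum.elim (fun _ => 0) (fun _ => 1)

/-- Koszul sign -/
def eps (F : Type) [Field F] {α β : Type} (x y : α ⊕ β) : F := (-1) ^ ((par x * par y).val)

/-- adjacent transposition -/
def sw {n : ℕ} (i : ℕ) (hi : i + 1 < n) : Equiv.Perm (Fin n) :=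
  Equiv.swap (⟨i, Nat.lt_of_succ_lt hi⟩ : Fin n) ⟨i + 1, hi⟩

/-- inversion sign of a pair -/
def cc (F : Type) [Field F] {α : Type} {d : ℕ} : α ⊕ Fin d → α ⊕ Fin d → F
  | Sum.inr a, Sum.inr b => if b < a then -1 else 1
  | _, _ => 1

/-- pairs in increasing order -/
def pairs (n : ℕ) : Finset (Fin n × Fin n) := Finset.univ.filter (fun p => p.1 < p.2)

/-- sign of a word -/
def sgn (F : Type) [Field F] {α : Type} {d n : ℕ} (f : Fin n → α ⊕ Fin d) : F :=
  ∏ p ∈ pairs n, cc F (f p.1) (f p.2)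

/-- multiset of letters -/
def ms {ι : Type} {n : ℕ} (f : Fin n → ι) : Sym ι n :=
  ⟨Finset.univ.val.map f, by simp⟩

open Classical in
/-- no repeated odd letters -/
def good {α β : Type} {n : ℕ} (s : Sym (α ⊕ β) n) : Prop :=
  ∀ b : β, s.1.count (Sum.inr b) ≤ 1

/-- the functions on words satisfying the sign rule -/
def W (F : Type) [Field F] (α β : Type) (n : ℕ) : Submodule F ((Fin n → α ⊕ β) → F) where
  carrier := {u | ∀ f i (hi : i + 1 < n),
    u f = eps F (f ⟨i, Nat.lt_of_succ_lt hi⟩) (f ⟨i + 1, hi⟩) * u (f ∘ sw i hi)}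
  add_mem' := by
    intro u v hu hv f i hi
    simp only [Pi.add_apply, mul_add]
    rw [← hu f i hi, ← hv f i hi]
  zero_mem' := by intro f i hi; simp
  smul_mem' := by
    intro c u hu f i hi
    simp only [Pi.smul_apply, smul_eq_mul]
    rw [hu f i hi]; ring

theorem eps_mul_self (F : Type) [Field F] {α β : Type} (x y : α ⊕ β) :
    eps F x y * eps F x y = 1 := by
  unfold eps; rw [← mul_pow]; simp

theorem good_ms {α β : Type} {n : ℕ} (f : Fin n → α ⊕ β) :
    good (ms f) ↔ ∀ a b x, f a = Sum.inr x → f b = Sum.inr x → a = b := by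
  classical
  unfold good ms
  simp only [Multiset.count_map]
  have : ∀ x : β, (Multiset.filter (fun a => Sum.inr x = f a) Finset.univ.val).card =
    (Finset.univ.filter (fun a => f a = Sum.inr x)).card := by
    intro x
    simp [Finset.card, Finset.filter_val, eq_comm]
  constructor
  · intro h a b x ha hb
    have h1 := h x
    have h2 := this x
    have h3 : (Finset.univ.filter (fun a => f a = Sum.inr x)).card ≤ 1 := by
      rw [← h2]; convert h1
    rw [Finset.card_le_one] at h3
    exact h3 a (by simp [ha]) b (by simp [hb])
  · intro h x
    have h2 := this x
    have h3 : (Finset.univ.filter (fun a => f a = Sum.inr x)).card ≤ 1 := by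
      rw [Finset.card_le_one]
      intro a ha b hb
      exact h a b x (by simpa using ha) (by simpa using hb)
    rw [← h2] at h3
    convert h3

theorem ms_perm {ι : Type} {n : ℕ} (f : Fin n → ι) (σ : Equiv.Perm (Fin n)) :
    ms (f ∘ σ) = ms f := by
  apply Subtype.ext
  simp only [ms]
  rw [← Multiset.map_map, Multiset.map_univ_val_equiv]

theorem exists_perm {ι : Type} {n : ℕ} (f g : Fin n → ι) (h : ms f = ms g) :
    ∃ σ : Equiv.Perm (Fin n), f = g ∘ σ := by
  classical
  have h' : Finset.univ.val.map f = Finset.univ.val.map g := congrArg Subtype.val h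
  have key : ∀ c, Fintype.card {a // f a = c} = Fintype.card {b // g b = c} := by
    intro c
    have := congrArg (Multiset.count c) h'
    rw [Multiset.count_map, Multiset.count_map] at this
    rw [Fintype.card_subtype, Fintype.card_subtype]
    simpa [Finset.card, Finset.filter_val, eq_comm] using this
  refine ⟨Equiv.ofFiberEquiv (fun c => Fintype.equivOfCardEq (key c)), ?_⟩
  funext a
  exact (Equiv.ofFiberEquiv_map _ a).symm

theorem ms_surj {ι : Type} {n : ℕ} (s : Sym ι n) : ∃ f : Fin n → ι, ms f = s := by
  obtain ⟨s, hs⟩ := s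
  induction s using Quotient.inductionOn with
  | h l =>
    have hl : l.length = n := by simpa using hs
    subst hl
    refine ⟨l.get, Subtype.ext ?_⟩
    simp [ms, Fin.univ_val_map]

/-- induction over adjacent transpositions -/
theorem perm_ind {n : ℕ} (P : Equiv.Perm (Fin n) → Prop) (h1 : P 1)
    (hs : ∀ σ i (hi : i + 1 < n), P σ → P (σ * sw i hi)) (σ : Equiv.Perm (Fin n)) : P σ := by
  cases n with
  | zero => rwa [Subsingleton.elim σ 1]
  | succ m =>
    have hσ : σ ∈ Submonoid.closure (Set.range fun i : Fin m ↦ Equiv.swap i.castSucc i.succ) := by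
      rw [Equiv.Perm.mclosure_swap_castSucc_succ]; trivial
    induction hσ using Submonoid.closure_induction_right with
    | one => exact h1
    | mul_right x hx y hy ih =>
      obtain ⟨i, rfl⟩ := hy
      exact hs x i (by omega) ih

theorem cc_self (F : Type) [Field F] {α : Type} {d : ℕ} (x y : α ⊕ Fin d) :
    cc F x y * cc F x y = 1 := by
  rcases x with x | x <;> rcases y with y | y <;> simp only [cc, mul_one]
  split_ifs <;> simp

theorem cc_swap (F : Type) [Field F] {α : Type} {d : ℕ} (x y : α ⊕ Fin d)
    (h : ∀ z, x = Sum.inr z → y = Sum.inr z → False) :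
    cc F y x = eps F x y * cc F x y := by
  rcases x with x | x <;> rcases y with y | y <;> simp [cc, eps, par]
  have hxy : x ≠ y := fun e => h x rfl (by rw [e])
  have h1 : (1 : ZMod 2).val = 1 := rfl
  rcases lt_or_gt_of_ne hxy with h | h
  · simp [h, not_lt_of_gt h, h1]
  · simp [h, not_lt_of_gt h, h1]

theorem sgn_self (F : Type) [Field F] {α : Type} {d n : ℕ} (f : Fin n → α ⊕ Fin d) :
    sgn F f * sgn F f = 1 := by
  unfold sgn
  rw [← Finset.prod_mul_distrib]
  exact Finset.prod_eq_one fun p _ => cc_self F _ _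

theorem sw_lt {n : ℕ} (i : ℕ) (hi : i + 1 < n) (a b : Fin n) (h : a < b)
    (h' : ¬ (a.1 = i ∧ b.1 = i + 1)) : sw i hi a < sw i hi b := by
  unfold sw
  simp only [Equiv.swap_apply_def, Fin.ext_iff]
  rw [Fin.lt_def] at *
  split_ifs <;> simp at * <;> omega

theorem sw_sw {n : ℕ} (i : ℕ) (hi : i + 1 < n) (a : Fin n) : sw i hi (sw i hi a) = a := by
  simp [sw]

theorem sgn_sw (F : Type) [Field F] {α : Type} {d n : ℕ} (f : Fin n → α ⊕ Fin d)
    (hf : good (ms f)) (i : ℕ) (hi : i + 1 < n) :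
    sgn F (f ∘ sw i hi) = eps F (f ⟨i, Nat.lt_of_succ_lt hi⟩) (f ⟨i + 1, hi⟩) * sgn F f := by
  rw [good_ms] at hf
  set q : Fin n × Fin n := (⟨i, Nat.lt_of_succ_lt hi⟩, ⟨i + 1, hi⟩) with hq
  have hqm : q ∈ pairs n := by simp [pairs, q]
  have e1 : sw i hi q.1 = q.2 := by simp [sw, q]
  have e2 : sw i hi q.2 = q.1 := by simp [sw, q]
  unfold sgn
  rw [← Finset.mul_prod_erase _ _ hqm, ← Finset.mul_prod_erase _ _ hqm, ← mul_assoc]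
  congr 1
  · simp only [Function.comp, e1, e2]
    apply cc_swap
    intro z h1 h2
    have := hf _ _ z h1 h2
    simp [q] at this
  · have hmem : ∀ a ∈ (pairs n).erase q, (sw i hi a.1, sw i hi a.2) ∈ (pairs n).erase q := by
      rintro ⟨a, b⟩ hab
      simp only [Finset.mem_erase, pairs, Finset.mem_filter, Finset.mem_univ, true_and] at hab ⊢
      refine ⟨?_, sw_lt i hi a b hab.2 ?_⟩
      · intro h
        have h1 : sw i hi a = q.1 := congrArg Prod.fst h
        have h2 : sw i hi b = q.2 := congrArg Prod.snd h
        have h3 : a = q.2 := by rw [← e1, ← h1, sw_sw]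
        have h4 : b = q.1 := by rw [← e2, ← h2, sw_sw]
        have := hab.2
        rw [h3, h4] at this
        simp [q, Fin.lt_def] at this
      · rintro ⟨h1, h2⟩
        exact hab.1 (Prod.ext (Fin.ext h1) (Fin.ext h2))
    refine Finset.prod_nbij' (fun p => (sw i hi p.1, sw i hi p.2))
      (fun p => (sw i hi p.1, sw i hi p.2)) hmem hmem ?_ ?_ ?_
    · intro a _; simp [sw_sw]
    · intro a _; simp [sw_sw]
    · intro a _; rfl

/-- the index set of the basis -/
abbrev T (α β : Type) (n : ℕ) : Type := {s : Sym (α ⊕ β) n // good s}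

open Classical in
/-- the parametrisation of `W` -/
noncomputable def L (F : Type) [Field F] (α : Type) (d n : ℕ) :
    (T α (Fin d) n → F) →ₗ[F] ((Fin n → α ⊕ Fin d) → F) where
  toFun ψ f := if h : good (ms f) then sgn F f * ψ ⟨ms f, h⟩ else 0
  map_add' ψ χ := by
    funext f
    simp only [Pi.add_apply]
    split_ifs <;> simp [mul_add]
  map_smul' c ψ := by
    funext f
    simp only [Pi.smul_apply, smul_eq_mul, RingHom.id_apply]
    split_ifs
    · ring
    · simp

theorem L_inj (F : Type) [Field F] (α : Type) (d n : ℕ) : Function.Injective (L F α d n) := by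
  intro ψ χ h
  funext ⟨s, hs⟩
  obtain ⟨f, rfl⟩ := ms_surj s
  have := congrFun h f
  simp only [L, LinearMap.coe_mk, AddHom.coe_mk, dif_pos hs] at this
  have h2 := congrArg (fun z => sgn F f * z) this
  simpa only [← mul_assoc, sgn_self, one_mul] using h2

theorem W_bad (F : Type) [Field F] (hchar : (2 : F) ≠ 0) (α : Type) (d n : ℕ)
    (u : (Fin n → α ⊕ Fin d) → F) (hu : u ∈ W F α (Fin d) n) (f : Fin n → α ⊕ Fin d)
    (hf : ¬ good (ms f)) : u f = 0 := by
  rw [good_ms] at hf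
  push Not at hf
  obtain ⟨a, b, x, ha, hb, hab⟩ := hf
  have hn : 0 + 1 < n := by
    have := a.2; have := b.2
    have : a.1 ≠ b.1 := fun h => hab (Fin.ext h)
    omega
  have key : ∀ σ : Equiv.Perm (Fin n), u (f ∘ σ) = 0 → u f = 0 := by
    intro σ
    induction σ using perm_ind with
    | h1 => intro h; exact h
    | hs σ i hi ih =>
      intro h
      apply ih
      rw [hu (f ∘ σ) i hi]
      have : (f ∘ σ) ∘ sw i hi = f ∘ (σ * sw i hi) := rfl
      rw [this, h, mul_zero]
  obtain ⟨σ, h0, h1⟩ : ∃ σ : Equiv.Perm (Fin n), σ ⟨0, by omega⟩ = a ∧ σ ⟨0 + 1, hn⟩ = b := by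
    set z : Fin n := ⟨0, by omega⟩
    set o : Fin n := ⟨0 + 1, hn⟩
    have hzo : z ≠ o := by simp [z, o]
    refine ⟨Equiv.swap (Equiv.swap z a o) b * Equiv.swap z a, ?_, ?_⟩
    · simp only [Equiv.Perm.mul_apply, Equiv.swap_apply_left]
      apply Equiv.swap_apply_of_ne_of_ne _ hab
      intro h
      apply hzo
      apply (Equiv.swap z a).injective
      rw [← h]; simp
    · simp
  apply key σ
  have h := hu (f ∘ σ) 0 hn
  have e1 : (f ∘ σ) ⟨0, by omega⟩ = Sum.inr x := by simp only [Function.comp, h0, ha]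
  have e2 : (f ∘ σ) ⟨0 + 1, hn⟩ = Sum.inr x := by simp only [Function.comp, h1, hb]
  have e3 : (f ∘ σ) ∘ sw 0 hn = f ∘ σ := by
    funext k
    simp only [sw, Function.comp_apply, Equiv.swap_apply_def]
    simp only [Function.comp_apply] at e1 e2
    split_ifs with h1 h2
    · rw [h1, e1, e2]
    · rw [h2, e1, e2]
    · rfl
  have e4 : eps F (Sum.inr x : α ⊕ Fin d) (Sum.inr x) = -1 := by
    have h1 : (1 : ZMod 2).val = 1 := rfl
    simp [eps, par, h1]
  rw [e1, e2, e3, e4] at h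
  have : (2 : F) * u (f ∘ σ) = 0 := by linear_combination h
  exact (mul_eq_zero.mp this).resolve_left hchar

theorem L_range (F : Type) [Field F] (hchar : (2 : F) ≠ 0) (α : Type) (d n : ℕ) :
    LinearMap.range (L F α d n) = W F α (Fin d) n := by
  apply le_antisymm
  · rintro _ ⟨ψ, rfl⟩ f i hi
    have hm := ms_perm f (sw i hi)
    by_cases h : good (ms f)
    · have h' : good (ms (f ∘ sw i hi)) := by rwa [hm]
      simp only [L, LinearMap.coe_mk, AddHom.coe_mk, dif_pos h, dif_pos h']
      rw [sgn_sw F f h, ← mul_assoc, ← mul_assoc, eps_mul_self, one_mul]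
      congr 2
      exact Subtype.ext hm.symm
    · have h' : ¬ good (ms (f ∘ sw i hi)) := by rwa [hm]
      simp only [L, LinearMap.coe_mk, AddHom.coe_mk, dif_neg h, dif_neg h', mul_zero]
  · intro u hu
    choose w hw using fun t : T α (Fin d) n => ms_surj t.1
    refine ⟨fun t => sgn F (w t) * u (w t), ?_⟩
    funext f
    by_cases h : good (ms f)
    · simp only [L, LinearMap.coe_mk, AddHom.coe_mk, dif_pos h]
      have hinv : ∀ σ : Equiv.Perm (Fin n), sgn F (f ∘ σ) * u (f ∘ σ) = sgn F f * u f := by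
        intro σ
        induction σ using perm_ind with
        | h1 => rfl
        | hs σ i hi ih =>
          rw [← ih]
          have : f ∘ (σ * sw i hi) = (f ∘ σ) ∘ sw i hi := rfl
          have hg : good (ms (f ∘ σ)) := by rwa [ms_perm]
          rw [this, sgn_sw F (f ∘ σ) hg, hu (f ∘ σ) i hi]
          ring
      obtain ⟨σ, hσ⟩ := exists_perm _ _ (hw ⟨ms f, h⟩)
      rw [hσ, hinv, ← mul_assoc, sgn_self, one_mul]
    · simp only [L, LinearMap.coe_mk, AddHom.coe_mk, dif_neg h]
      exact (W_bad F hchar α d n u hu f h).symm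

theorem disjSum_surj {α β : Type} (s : Multiset (α ⊕ β)) :
    ∃ B : Multiset α, ∃ A : Multiset β, B.disjSum A = s := by
  induction s using Multiset.induction with
  | empty => exact ⟨0, 0, by simp⟩
  | cons x s ih =>
    obtain ⟨B, A, rfl⟩ := ih
    rcases x with x | x
    · exact ⟨x ::ₘ B, A, by simp [Multiset.disjSum]⟩
    · exact ⟨B, x ::ₘ A, by simp [Multiset.disjSum]⟩

theorem count_inr {α β : Type} [DecidableEq (α ⊕ β)] [DecidableEq β]
    (B : Multiset α) (A : Multiset β) (b : β) :
    (B.disjSum A).count (Sum.inr b) = A.count b := by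
  unfold Multiset.disjSum
  rw [Multiset.count_add, Multiset.count_map_eq_count' _ _ Sum.inr_injective]
  simp [Multiset.count_eq_zero]

theorem count_inl {α β : Type} [DecidableEq (α ⊕ β)] [DecidableEq α]
    (B : Multiset α) (A : Multiset β) (b : α) :
    (B.disjSum A).count (Sum.inl b) = B.count b := by
  unfold Multiset.disjSum
  rw [Multiset.count_add, Multiset.count_map_eq_count' _ _ Sum.inl_injective]
  simp [Multiset.count_eq_zero]

theorem disjSum_inj {α β : Type} {B B' : Multiset α} {A A' : Multiset β}
    (h : B.disjSum A = B'.disjSum A') : B = B' ∧ A = A' := by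
  classical
  constructor
  · ext b; rw [← count_inl B A, h, count_inl]
  · ext b; rw [← count_inr B A, h, count_inr]

theorem good_disjSum {α β : Type} {n : ℕ} (B : Multiset α) (A : Multiset β)
    (h : (B.disjSum A).card = n) : good (⟨B.disjSum A, h⟩ : Sym (α ⊕ β) n) ↔ A.Nodup := by
  classical
  rw [Multiset.nodup_iff_count_le_one]
  unfold good
  refine forall_congr' fun b => ?_
  rw [← count_inr B A b]

theorem card_T (d₀ d₁ n : ℕ) : Nat.card (T (Fin d₀) (Fin d₁) n) =
    ∑ k ∈ Finset.range (min d₁ n + 1),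
          Nat.choose d₁ k * Nat.choose (d₀ + (n - k) - 1) (n - k) := by
  classical
  rw [Nat.card_eq_fintype_card, ← Finset.card_univ]
  let S : Finset (Σ k : ℕ, Finset (Fin d₁) × Sym (Fin d₀) (n - k)) :=
    (Finset.range (min d₁ n + 1)).sigma
      fun k => Finset.powersetCard k Finset.univ ×ˢ Finset.univ
  have hS : S.card = ∑ k ∈ Finset.range (min d₁ n + 1),
          Nat.choose d₁ k * Nat.choose (d₀ + (n - k) - 1) (n - k) := by
    rw [Finset.card_sigma]
    refine Finset.sum_congr rfl fun k _ => ?_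
    rw [Finset.card_product, Finset.card_powersetCard, Finset.card_univ, Finset.card_univ,
      Sym.card_sym_eq_choose, Fintype.card_fin, Fintype.card_fin]
  rw [← hS]
  symm
  have hc : ∀ x ∈ S, (x.2.2.1.disjSum x.2.1.val).card = n := by
    rintro ⟨k, A, B, hB⟩ hx
    simp only [S, Finset.mem_sigma, Finset.mem_range, Finset.mem_product,
      Finset.mem_powersetCard] at hx
    have h1 : A.val.card = k := hx.2.1.2
    simp only [Multiset.card_disjSum, hB, h1]
    omega
  refine Finset.card_bij (fun x hx => ⟨⟨x.2.2.1.disjSum x.2.1.val, hc x hx⟩,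
    (good_disjSum _ _ _).2 x.2.1.nodup⟩) (fun _ _ => Finset.mem_univ _) ?_ ?_
  · rintro ⟨k, A, B⟩ hx ⟨k', A', B'⟩ hx' h
    have h' : B.1.disjSum A.val = B'.1.disjSum A'.val := congrArg (fun t => t.1.1) h
    obtain ⟨hB, hA⟩ := disjSum_inj h'
    have hA := Finset.val_injective hA
    simp only [S, Finset.mem_sigma, Finset.mem_range, Finset.mem_product,
      Finset.mem_powersetCard] at hx hx'
    have hk : k = k' := by rw [← hx.2.1.2, ← hx'.2.1.2, hA]
    subst hk
    have hB := Subtype.ext hB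
    rw [hA, hB]
  · rintro ⟨⟨s, hs⟩, hg⟩ _
    obtain ⟨B, A, rfl⟩ := disjSum_surj s
    have hA := (good_disjSum B A hs).1 hg
    rw [Multiset.card_disjSum] at hs
    refine ⟨⟨A.card, ⟨A, hA⟩, ⟨B, by omega⟩⟩, ?_, rfl⟩
    have h1 : A.card ≤ d₁ := by
      have := Finset.card_le_univ (⟨A, hA⟩ : Finset (Fin d₁))
      simpa using this
    simp only [S, Finset.mem_sigma, Finset.mem_range, Finset.mem_product,
      Finset.mem_powersetCard, Finset.mem_univ, and_true, Finset.subset_univ, true_and]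
    exact ⟨by omega, rfl, Finset.mem_univ _⟩

theorem finrank_W (F : Type) [Field F] (hchar : (2 : F) ≠ 0) (d₀ d₁ n : ℕ) :
    Module.finrank F (W F (Fin d₀) (Fin d₁) n) = ∑ k ∈ Finset.range (min d₁ n + 1),
          Nat.choose d₁ k * Nat.choose (d₀ + (n - k) - 1) (n - k) := by
  classical
  rw [← card_T, ← L_range F hchar, LinearMap.finrank_range_of_inj (L_inj F _ _ _),
    Module.finrank_fintype_fun_eq_card, Nat.card_eq_fintype_card]

/-- homogeneous basis -/
theorem exists_basis (F : Type) [Field F] (V : Type) [AddCommGroup V] [Module F V]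
    [FiniteDimensional F V] (gV : ZMod 2 → Submodule F V) (hgV : DirectSum.IsInternal gV) :
    ∃ b : Module.Basis (Fin (Module.finrank F (gV 0)) ⊕ Fin (Module.finrank F (gV 1))) F V,
      (∀ x, b x ∈ gV (par x)) ∧ ∀ q, ∀ v ∈ gV q, ∀ x, b.repr v x ≠ 0 → par x = q := by
  have hc : IsCompl (gV 0) (gV 1) := hgV.isCompl (by decide) (by
    ext x; revert x; simp; decide)
  let b := ((Module.finBasis F (gV 0)).prod (Module.finBasis F (gV 1))).map
    (Submodule.prodEquivOfIsCompl _ _ hc)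
  refine ⟨b, ?_, ?_⟩
  · rintro (x | x) <;> simp [b, par]
  · intro q v hv x hx
    have hq : q = 0 ∨ q = 1 := by clear hv; revert q; decide
    rcases hq with rfl | rfl
    · have := (Submodule.projectionOnto_apply_eq_zero_iff hc.symm).2 hv
      rcases x with x | x
      · rfl
      · simp [b, this] at hx
    · have := (Submodule.projectionOnto_apply_eq_zero_iff hc).2 hv
      rcases x with x | x
      · simp [b, this] at hx
      · rfl

end SuperPow

/-- For a finite-dimensional vector superspace `V` with even dimension `d₀`
and odd dimension `d₁`, the `n`-th symmetric superpower `⋁ⁿV := (⊗ⁿV)/Řₙ` (where `Řₙ`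
is spanned by `⊗v - (-1)^{ε(vᵢ)ε(v_{i+1})} τ_{i,i+1}(⊗v)` for homogeneous `v_k`) has
dimension `Σ_{k=0}^{min(d₁,n)} C(d₁,k) · C(d₀+(n-k)-1, n-k)`. -/
theorem dim_symmetric_superpower
    (F : Type) [Field F] (hchar : (2 : F) ≠ 0) (n : ℕ) (hn : 2 ≤ n)
    (V : Type) [AddCommGroup V] [Module F V] [FiniteDimensional F V]
    (gV : ZMod 2 → Submodule F V) (hgV : DirectSum.IsInternal gV) :
    let R : Submodule F (⨂[F] (_ : Fin n), V) := Submodule.span F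
      {t | ∃ (p : Fin n → ZMod 2) (v : Fin n → V) (i : ℕ) (hi : i + 1 < n),
        (∀ k, v k ∈ gV (p k)) ∧
        t = (⨂ₜ[F] k, v k) -
          ((-1 : F) ^ ((p ⟨i, by omega⟩ * p ⟨i + 1, hi⟩).val)) •
            ⨂ₜ[F] k, v (Equiv.swap (⟨i, by omega⟩ : Fin n) ⟨i + 1, hi⟩ k)}
    let d₀ := Module.finrank F (gV 0)
    let d₁ := Module.finrank F (gV 1)
    Module.finrank F ((⨂[F] (_ : Fin n), V) ⧸ R)
      = ∑ k ∈ Finset.range (min d₁ n + 1),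
          Nat.choose d₁ k * Nat.choose (d₀ + (n - k) - 1) (n - k) := by
  classical
  intro R d₀ d₁
  rw [← SuperPow.finrank_W F hchar d₀ d₁ n]
  obtain ⟨b, hb, hb'⟩ := SuperPow.exists_basis F V gV hgV
  rw [← Subspace.dual_finrank_eq, (Submodule.dualQuotEquivDualAnnihilator R).finrank_eq]
  let B := Basis.piTensorProduct (fun _ : Fin n => b)
  let e := (B.constr F (M' := F)).symm
  rw [← LinearEquiv.finrank_map_eq e]
  have he : ∀ (φ : Module.Dual F (⨂[F] (_ : Fin n), V)) f,
      e φ f = φ (⨂ₜ[F] k, b (f k)) := by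
    intro φ f
    simp only [e, B, Module.Basis.constr_symm_apply, Function.comp_apply,
      Basis.piTensorProduct_apply]
  have hexp : ∀ (φ : Module.Dual F (⨂[F] (_ : Fin n), V)) (v : Fin n → V),
      φ (⨂ₜ[F] k, v k) = ∑ f : Fin n → Fin d₀ ⊕ Fin d₁, (∏ k, b.repr (v k) (f k)) * e φ f := by
    intro φ v
    conv_lhs => rw [← B.sum_repr (⨂ₜ[F] k, v k), map_sum]
    refine Finset.sum_congr rfl fun f _ => ?_
    rw [map_smul, smul_eq_mul, he]
    simp only [B, Basis.piTensorProduct_apply, Basis.piTensorProduct_repr_tprod_apply]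
  suffices h : Submodule.map (e : _ →ₗ[F] _) R.dualAnnihilator = SuperPow.W F (Fin d₀) (Fin d₁) n by
    rw [h]
  ext u
  rw [Submodule.mem_map]
  constructor
  · rintro ⟨φ, hφ, rfl⟩ f i hi
    rw [Submodule.mem_dualAnnihilator] at hφ
    have := hφ _ (Submodule.subset_span ⟨fun k => SuperPow.par (f k), fun k => b (f k), i, hi,
      fun k => hb _, rfl⟩)
    rw [map_sub, map_smul, smul_eq_mul, sub_eq_zero] at this
    change e φ f = _ * e φ _
    rw [he, he, this]
    rfl
  · intro hu
    refine ⟨e.symm u, ?_, e.apply_symm_apply u⟩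
    rw [Submodule.mem_dualAnnihilator]
    suffices h : R ≤ LinearMap.ker (e.symm u) from fun w hw => h hw
    refine Submodule.span_le.2 ?_
    rintro _ ⟨p, v, i, hi, hv, rfl⟩
    simp only [SetLike.mem_coe, LinearMap.mem_ker]
    rw [map_sub, map_smul, smul_eq_mul, hexp, hexp, sub_eq_zero, e.apply_symm_apply]
    let s := SuperPow.sw i hi
    rw [← (Equiv.arrowCongr s (Equiv.refl (Fin d₀ ⊕ Fin d₁))).sum_comp (fun f =>
      (∏ k, b.repr (v (Equiv.swap (⟨i, by omega⟩ : Fin n) ⟨i + 1, hi⟩ k)) (f k)) * u f)]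
    rw [Finset.mul_sum]
    refine Finset.sum_congr rfl fun f _ => ?_
    have hf : (Equiv.arrowCongr s (Equiv.refl (Fin d₀ ⊕ Fin d₁))) f = f ∘ s := by
      funext k
      simp [Equiv.arrowCongr, s, SuperPow.sw]
    rw [hf]
    have hprod : (∏ k, b.repr (v (Equiv.swap (⟨i, by omega⟩ : Fin n) ⟨i + 1, hi⟩ k)) ((f ∘ s) k))
        = ∏ k, b.repr (v k) (f k) :=
      Equiv.prod_comp s (fun k => b.repr (v k) (f k))
    rw [hprod]
    by_cases hz : ∏ k, b.repr (v k) (f k) = 0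
    · rw [hz]; simp
    · have hz := Finset.prod_ne_zero_iff.1 hz
      have hp : ∀ k, SuperPow.par (f k) = p k := fun k =>
        hb' _ _ (hv k) _ (hz k (Finset.mem_univ k))
      rw [hu f i hi, SuperPow.eps, hp, hp]
      ring
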